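/- arXiv:0807.2198 — 2 statements merged into one kernel-verified Lean document; each statement's English description precedes it below -/
import Mathlib

section
/- For n ≥ 2, in the Coxeter system (W_n, {t_1,…,t_n}) of type B_n, consider the reduced word 𝐰 = (t_n, t_{n−1}, …, t_2, t_1, t_2, …, t_{n−1}, t_n, t_{n−1}, …, t_2, t_1, t_2, …, t_{n−1}) of length 4n−4 and its subexpression δ = (1, t_{n−1}, …, t_2, t_1, 1, 1, …, 1, t_1, t_2, …, t_{n−1}) (i.e. δ_i = 1 at position 1, δ_i equals the letter of 𝐰 at positions 2 through n, δ_i = 1 at the 2n−3 middle positions n+1 through 3n−3, and δ_i equals the letter of 𝐰 at the last n−1 positions). Then: (a) δ is distinguished; (b) the total product δ^{4n−4} equals the identity of W_n; (c) |I(δ)| = 2n−2; (d) |J(δ)| = n−1. Consequently the associated Deodhar cell k^{|I(δ)|−|J(δ)|} × (kˣ)^{(4n−4)−|I(δ)|} has dimension (4n−4) − |J(δ)| = 3n−3. -/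
namespace DeodharBn

/-- The Coxeter matrix of type Bₙ with the paper's convention:
`m(t₁,t₂) = 4`, `m(tᵢ,tᵢ₊₁) = 3` for `2 ≤ i ≤ n−1`, and `m(tᵢ,tⱼ) = 2` for `|i−j| ≥ 2`
(here `tᵢ` corresponds to the index `i - 1 : Fin n`). -/
def BnMatrix (n : ℕ) : CoxeterMatrix (Fin n) where
  M := Matrix.of fun i j : Fin n =>
    if (i : ℕ) = (j : ℕ) then 1
    else if ((i : ℕ) = 0 ∧ (j : ℕ) = 1) ∨ ((i : ℕ) = 1 ∧ (j : ℕ) = 0) then 4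
    else if (i : ℕ) + 1 = (j : ℕ) ∨ (j : ℕ) + 1 = (i : ℕ) then 3
    else 2
  isSymm := by
    unfold Matrix.IsSymm
    ext i j
    simp only [Matrix.transpose_apply, Matrix.of_apply]
    split_ifs <;> omega
  diagonal := fun i => by simp
  off_diagonal := fun i j h => by
    have h' : (i : ℕ) ≠ (j : ℕ) := fun hc => h (Fin.ext hc)
    simp only [Matrix.of_apply]
    split_ifs <;> omega

/-- The letter (as an index in `Fin n`, with `tᵢ` corresponding to `i - 1`) at position `i`
(`0`-based) of the word
`𝐰 = (tₙ, tₙ₋₁, …, t₂, t₁, t₂, …, tₙ₋₁, tₙ, tₙ₋₁, …, t₂, t₁, t₂, …, tₙ₋₁)`. -/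
def bLetter (n : ℕ) (hn : 2 ≤ n) (i : ℕ) : Fin n :=
  if _h : i % (2 * n - 2) ≤ n - 1 then
    ⟨n - 1 - i % (2 * n - 2), by omega⟩
  else
    ⟨i % (2 * n - 2) - n + 1, by
      have h2 : i % (2 * n - 2) < 2 * n - 2 := Nat.mod_lt _ (by omega)
      omega⟩

/-- The word `𝐰 = (tₙ, tₙ₋₁, …, t₂, t₁, t₂, …, tₙ₋₁, tₙ, tₙ₋₁, …, t₂, t₁, t₂, …, tₙ₋₁)`
of length `4n − 4`. -/
def bWord (n : ℕ) (hn : 2 ≤ n) : List (Fin n) :=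
  List.ofFn fun i : Fin (4 * n - 4) => bLetter n hn (i : ℕ)

variable {n : ℕ} (hn : 2 ≤ n) {W : Type*} [Group W] (cs : CoxeterSystem (BnMatrix n) W)

/-- The subexpression of `𝐰` encoded by `b : Fin (4n−4) → Bool`:
entry `i` is the letter of `𝐰` at position `i` if `b i = true` and `1` otherwise. -/
def subexpr (b : Fin (4 * n - 4) → Bool) : Fin (4 * n - 4) → W :=
  fun i => if b i then cs.simple (bLetter n hn (i : ℕ)) else 1

/-- The partial product `γ^m = γ₁ ⋯ γₘ` (product of the first `m` entries) of the
subexpression encoded by `b`. -/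
def partialProd (b : Fin (4 * n - 4) → Bool) (m : ℕ) : W :=
  ((List.ofFn (subexpr hn cs b)).take m).prod

/-- The subexpression encoded by `b` is distinguished:
`ℓ(γ^{i−1} s_{a i}) < ℓ(γ^{i−1})` implies `γ i = s_{a i}`. -/
def Distinguished (b : Fin (4 * n - 4) → Bool) : Prop :=
  ∀ i : Fin (4 * n - 4),
    cs.length (partialProd hn cs b (i : ℕ) * cs.simple (bLetter n hn (i : ℕ))) <
      cs.length (partialProd hn cs b (i : ℕ)) → b i = true

/-- `|I(γ)|`, the number of positions where the subexpression entry equals the letter of the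
word (rather than `1`). -/
def cardI (b : Fin (4 * n - 4) → Bool) : ℕ :=
  (Finset.univ.filter fun i : Fin (4 * n - 4) => b i = true).card

/-- `|J(γ)|`, the number of positions `i` with `ℓ(γ^i s_{a i}) < ℓ(γ^i)`. -/
noncomputable def cardJ (b : Fin (4 * n - 4) → Bool) : ℕ :=
  (Finset.univ.filter fun i : Fin (4 * n - 4) =>
    cs.length (partialProd hn cs b ((i : ℕ) + 1) * cs.simple (bLetter n hn (i : ℕ))) <
      cs.length (partialProd hn cs b ((i : ℕ) + 1))).card

/-- The Boolean encoding of the subexpression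
`δ = (1, tₙ₋₁, …, t₂, t₁, 1, 1, …, 1, t₁, t₂, …, tₙ₋₁)` of `𝐰`:
`δ i = 1` at position `1`, `δ` equals the letter of `𝐰` at positions `2` through `n`,
`δ i = 1` at the `2n−3` middle positions `n+1` through `3n−3`, and `δ` equals the letter
of `𝐰` at the last `n−1` positions (positions are `1`-based here; the encoding below is
`0`-based). -/
def deltaSel (n : ℕ) (i : Fin (4 * n - 4)) : Bool :=
  decide ((1 ≤ (i : ℕ) ∧ (i : ℕ) ≤ n - 1) ∨ 3 * n - 3 ≤ (i : ℕ))

/-- Action of the generator with index `j` on bit sequences. -/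
def bitFun (j : ℕ) (f : ℕ → Bool) : ℕ → Bool := fun k =>
  if j = 0 then (if k = 0 then !(f 0) else f k)
  else if k + 1 = j then f j else if k = j then f (j - 1) else f k

theorem bitFun_invol (j : ℕ) (f : ℕ → Bool) : bitFun j (bitFun j f) = f := by
  funext k
  simp only [bitFun]
  rcases Nat.eq_zero_or_pos j with rfl | hj
  · by_cases hk : k = 0 <;> simp [hk]
  · grind

/-- The generator action as a permutation. -/
def bitPerm (j : ℕ) : Equiv.Perm (ℕ → Bool) :=
  ⟨bitFun j, bitFun j, bitFun_invol j, bitFun_invol j⟩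

theorem bitPerm_apply (j : ℕ) (f : ℕ → Bool) : bitPerm j f = bitFun j f := rfl

theorem bit_comm (i j : ℕ) (h : i + 2 ≤ j) (f : ℕ → Bool) :
    bitFun i (bitFun j f) = bitFun j (bitFun i f) := by
  funext k
  simp only [bitFun]
  grind

theorem bit_braid3 (i j : ℕ) (h : i + 1 = j) (hi : i ≠ 0) (f : ℕ → Bool) :
    bitFun i (bitFun j (bitFun i f)) = bitFun j (bitFun i (bitFun j f)) := by
  subst h
  obtain ⟨i, rfl⟩ := Nat.exists_eq_succ_of_ne_zero hi
  funext k
  simp only [bitFun]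
  grind

theorem bit_braid4 (f : ℕ → Bool) :
    bitFun 0 (bitFun 1 (bitFun 0 (bitFun 1 f))) = bitFun 1 (bitFun 0 (bitFun 1 (bitFun 0 f))) := by
  funext k
  simp only [bitFun]
  grind

theorem bit_liftable (n : ℕ) : (BnMatrix n).IsLiftable (fun i : Fin n => bitPerm (i : ℕ)) := by
  intro i j
  have hM : (BnMatrix n).M i j = if (i : ℕ) = (j : ℕ) then 1
    else if ((i : ℕ) = 0 ∧ (j : ℕ) = 1) ∨ ((i : ℕ) = 1 ∧ (j : ℕ) = 0) then 4
    else if (i : ℕ) + 1 = (j : ℕ) ∨ (j : ℕ) + 1 = (i : ℕ) then 3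
    else 2 := rfl
  change (bitPerm (i : ℕ) * bitPerm (j : ℕ)) ^ ((BnMatrix n).M i j) = 1
  rw [hM]
  generalize (i : ℕ) = a
  generalize (j : ℕ) = b
  refine Equiv.ext fun f => ?_
  split_ifs with h1 h2 h3
  · subst h1
    simp only [pow_succ, pow_zero, one_mul, Equiv.Perm.mul_apply, bitPerm_apply, bitFun_invol,
      Equiv.Perm.one_apply]
  · simp only [pow_succ, pow_zero, one_mul, Equiv.Perm.mul_apply, bitPerm_apply,
      Equiv.Perm.one_apply]
    rcases h2 with ⟨rfl, rfl⟩ | ⟨rfl, rfl⟩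
    · rw [bit_braid4]; simp only [bitFun_invol]
    · rw [← bit_braid4]; simp only [bitFun_invol]
  · simp only [pow_succ, pow_zero, one_mul, Equiv.Perm.mul_apply, bitPerm_apply,
      Equiv.Perm.one_apply]
    rcases h3 with h | h
    · rw [bit_braid3 a b h (by omega)]; simp only [bitFun_invol]
    · rw [← bit_braid3 b a h (by omega)]; simp only [bitFun_invol]
  · simp only [pow_succ, pow_zero, one_mul, Equiv.Perm.mul_apply, bitPerm_apply,
      Equiv.Perm.one_apply]
    rcases Nat.lt_or_ge a b with h | h
    · rw [bit_comm a b (by omega)]; simp only [bitFun_invol]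
    · rw [← bit_comm b a (by omega)]; simp only [bitFun_invol]

/-- Potential of a bit sequence. -/
def pot (n : ℕ) (f : ℕ → Bool) : ℤ := ∑ i ∈ Finset.range n, if f i then (i : ℤ) + 1 else 0

theorem pot_step (n j : ℕ) (hj : j < n) (f : ℕ → Bool) : pot n (bitFun j f) ≤ pot n f + 1 := by
  have key : pot n (bitFun j f) - pot n f =
      ∑ i ∈ ({j - 1, j} : Finset ℕ), ((if bitFun j f i then (i : ℤ) + 1 else 0) -
        (if f i then (i : ℤ) + 1 else 0)) := by
    unfold pot
    rw [← Finset.sum_sub_distrib]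
    symm
    apply Finset.sum_subset
    · intro x hx
      simp only [Finset.mem_insert, Finset.mem_singleton] at hx
      simp only [Finset.mem_range]
      omega
    · intro x _ hx
      simp only [Finset.mem_insert, Finset.mem_singleton, not_or] at hx
      have : bitFun j f x = f x := by
        simp only [bitFun]
        grind
      rw [this, sub_self]
  rcases Nat.eq_zero_or_pos j with rfl | hp
  · simp [bitFun] at key
    cases h : f 0 <;> simp [h] at key <;> omega
  · rw [Finset.sum_pair (by omega)] at key
    have e1 : bitFun j f (j - 1) = f j := by
      simp only [bitFun]
      grind
    have e2 : bitFun j f j = f (j - 1) := by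
      simp only [bitFun]
      grind
    rw [e1, e2] at key
    have e3 : ((j - 1 : ℕ) : ℤ) = j - 1 := by omega
    rw [e3] at key
    split_ifs at key <;> omega

/-- The action of `W`. -/
noncomputable def actHom : W →* Equiv.Perm (ℕ → Bool) :=
  cs.lift ⟨fun i : Fin n => bitPerm (i : ℕ), bit_liftable n⟩

theorem actHom_simple (i : Fin n) : actHom cs (cs.simple i) = bitPerm (i : ℕ) :=
  cs.lift_apply_simple (bit_liftable n) i

theorem pot_word (ω : List (Fin n)) :
    pot n (actHom cs (cs.wordProd ω) (fun _ => false)) ≤ ω.length := by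
  induction ω with
  | nil => simp [pot]
  | cons i ω ih =>
    rw [cs.wordProd_cons, map_mul, Equiv.Perm.mul_apply, actHom_simple, bitPerm_apply]
    have := pot_step n i i.2 (actHom cs (cs.wordProd ω) (fun _ => false))
    push_cast [List.length_cons]
    omega

theorem pot_le_length (w : W) : pot n (actHom cs w (fun _ => false)) ≤ cs.length w := by
  obtain ⟨ω, h, rfl⟩ := cs.exists_isReduced w
  rw [h]
  exact pot_word cs ω

theorem pp_zero : partialProd hn cs (deltaSel n) 0 = 1 := by simp [partialProd]

theorem pp_succ (m : ℕ) (hm : m < 4 * n - 4) :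
    partialProd hn cs (deltaSel n) (m + 1) = partialProd hn cs (deltaSel n) m *
      (if (1 ≤ m ∧ m ≤ n - 1) ∨ 3 * n - 3 ≤ m then cs.simple (bLetter n hn m) else 1) := by
  unfold partialProd
  rw [List.prod_take_succ _ _ (by simpa using hm)]
  simp [subexpr, deltaSel]

theorem letter_low (m : ℕ) (hm : m ≤ n - 1) : (bLetter n hn m : ℕ) = n - 1 - m := by
  have : m % (2 * n - 2) = m := Nat.mod_eq_of_lt (by omega)
  simp [bLetter, this, hm]

theorem mod_high (m : ℕ) (h1 : 2 * n - 2 ≤ m) (h2 : m < 4 * n - 4) :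
    m % (2 * n - 2) = m - (2 * n - 2) := by
  rw [Nat.mod_eq_sub_mod h1, Nat.mod_eq_of_lt (by omega)]

theorem letter_high (k : ℕ) (hk : k + 1 < n) :
    (bLetter n hn (3 * n - 3 + k) : ℕ) = k := by
  have := mod_high (n := n) (3 * n - 3 + k) (by omega) (by omega)
  unfold bLetter
  split_ifs with h
  · simp only; omega
  · simp only; omega

theorem letter_mid (m : ℕ) (h1 : n ≤ m) (h2 : m < 3 * n - 3) :
    (bLetter n hn m : ℕ) ≠ 0 := by
  have : m % (2 * n - 2) ≠ n - 1 := by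
    rcases Nat.lt_or_ge m (2 * n - 2) with h | h
    · rw [Nat.mod_eq_of_lt h]; omega
    · rw [mod_high m h (by omega)]; omega
  unfold bLetter
  split_ifs with h
  · simp only; omega
  · simp only; omega

theorem pp_one : partialProd hn cs (deltaSel n) 1 = 1 := by
  have := pp_succ hn cs 0 (by omega)
  rw [if_neg (by omega)] at this
  simpa [pp_zero] using this

theorem pp_low (m : ℕ) (h1 : 1 ≤ m) (h2 : m ≤ n - 1) :
    partialProd hn cs (deltaSel n) (m + 1) = partialProd hn cs (deltaSel n) m *
      cs.simple (bLetter n hn m) := by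
  rw [pp_succ hn cs m (by omega), if_pos (by omega)]

theorem pp_mid (k : ℕ) (h : n + k ≤ 3 * n - 3) :
    partialProd hn cs (deltaSel n) (n + k) = partialProd hn cs (deltaSel n) n := by
  induction k with
  | zero => rfl
  | succ k ih =>
    rw [← ih (by omega), ← add_assoc, pp_succ hn cs _ (by omega), if_neg (by omega), mul_one]

theorem pp_high (k : ℕ) (h : k ≤ n - 1) :
    partialProd hn cs (deltaSel n) (3 * n - 3 + k) = partialProd hn cs (deltaSel n) (n - k) := by
  induction k with
  | zero =>
    have := pp_mid hn cs (2 * n - 3) (by omega)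
    rw [show n + (2 * n - 3) = 3 * n - 3 by omega] at this
    simpa using this
  | succ k ih =>
    rw [← add_assoc, pp_succ hn cs _ (by omega), if_pos (by omega), ih (by omega)]
    have h3 := pp_low hn cs (n - (k + 1)) (by omega) (by omega)
    rw [show n - (k + 1) + 1 = n - k by omega] at h3
    have h4 : bLetter n hn (n - (k + 1)) = bLetter n hn (3 * n - 3 + k) := by
      apply Fin.ext
      rw [letter_high hn k (by omega), letter_low hn _ (by omega)]
      omega
    rw [h3, h4, mul_assoc, cs.simple_mul_simple_self, mul_one]

theorem act_low (m : ℕ) (h : m + 2 ≤ n) :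
    actHom cs (partialProd hn cs (deltaSel n) (m + 1)) (fun i => decide (i = n - 2 - m)) =
      fun i => decide (i = n - 2) := by
  induction m with
  | zero => simp [pp_one]
  | succ m ih =>
    rw [pp_low hn cs (m + 1) (by omega) (by omega), map_mul, Equiv.Perm.mul_apply,
      actHom_simple, bitPerm_apply, letter_low hn _ (by omega), ← ih (by omega)]
    congr 1
    funext i
    simp only [bitFun]
    grind

theorem act_top : actHom cs (partialProd hn cs (deltaSel n) n) (fun _ => false) =
      fun i => decide (i = n - 2) := by
  have h3 := pp_low hn cs (n - 1) (by omega) (by omega)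
  rw [show n - 1 + 1 = n by omega] at h3
  have h4 := act_low hn cs (n - 2) (by omega)
  rw [show n - 2 + 1 = n - 1 by omega] at h4
  rw [h3, map_mul, Equiv.Perm.mul_apply, actHom_simple, bitPerm_apply,
    letter_low hn _ (by omega), ← h4]
  congr 1
  funext i
  simp only [bitFun]
  grind

theorem pot_top (hn : 2 ≤ n) : pot n (fun i => decide (i = n - 2)) = (n : ℤ) - 1 := by
  unfold pot
  rw [Finset.sum_eq_single (n - 2)]
  · simp; omega
  · intro b _ hb; simp [hb]
  · intro h; simp only [Finset.mem_range] at h; omega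

theorem len_top_le (hn : 2 ≤ n) (w : W)
    (h : actHom cs w (fun _ => false) = fun i => decide (i = n - 2)) : n - 1 ≤ cs.length w := by
  have := pot_le_length cs w
  rw [h, pot_top hn] at this
  omega

theorem len_le (m : ℕ) (h : m + 1 ≤ n) :
    cs.length (partialProd hn cs (deltaSel n) (m + 1)) ≤ m := by
  induction m with
  | zero => simp [pp_one]
  | succ m ih =>
    rw [pp_low hn cs (m + 1) (by omega) (by omega)]
    have h1 := cs.length_mul_le (partialProd hn cs (deltaSel n) (m + 1))
      (cs.simple (bLetter n hn (m + 1)))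
    rw [cs.length_simple] at h1
    have := ih (by omega)
    omega

theorem len_ge (k : ℕ) (h : k + 1 ≤ n) :
    n - 1 ≤ cs.length (partialProd hn cs (deltaSel n) (n - k)) + k := by
  induction k with
  | zero => exact len_top_le cs hn _ (act_top hn cs)
  | succ k ih =>
    have h3 := pp_low hn cs (n - (k + 1)) (by omega) (by omega)
    rw [show n - (k + 1) + 1 = n - k by omega] at h3
    have h1 := cs.length_mul_le (partialProd hn cs (deltaSel n) (n - (k + 1)))
      (cs.simple (bLetter n hn (n - (k + 1))))
    rw [cs.length_simple, ← h3] at h1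
    have := ih (by omega)
    omega

theorem len_low (m : ℕ) (h1 : 1 ≤ m) (h : m ≤ n) :
    cs.length (partialProd hn cs (deltaSel n) m) = m - 1 := by
  have a := len_le hn cs (m - 1) (by omega)
  have b := len_ge hn cs (n - m) (by omega)
  rw [show m - 1 + 1 = m by omega] at a
  rw [show n - (n - m) = m by omega] at b
  omega

theorem mid_not (m : ℕ) (h1 : n ≤ m) (h2 : m ≤ 3 * n - 3) (j : Fin n) (hj : (j : ℕ) ≠ 0) :
    ¬ cs.length (partialProd hn cs (deltaSel n) m * cs.simple j) <
      cs.length (partialProd hn cs (deltaSel n) m) := by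
  have e := pp_mid hn cs (m - n) (by omega)
  rw [show n + (m - n) = m by omega] at e
  rw [e, len_low hn cs n (by omega) le_rfl, not_lt]
  apply len_top_le cs hn
  rw [map_mul, Equiv.Perm.mul_apply, actHom_simple, bitPerm_apply, ← act_top hn cs]
  congr 1
  funext i
  simp only [bitFun]
  grind

theorem dist : Distinguished hn cs (deltaSel n) := by
  intro i hi
  by_contra hc
  simp only [deltaSel, decide_eq_true_eq] at hc
  rcases Nat.eq_zero_or_pos (i : ℕ) with h0 | h0
  · rw [h0, pp_zero] at hi
    simp at hi
  · exact mid_not hn cs i (by omega) (by omega) _ (letter_mid hn i (by omega) (by omega)) hi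

theorem J_iff (m : ℕ) (hm : m < 4 * n - 4) :
    cs.length (partialProd hn cs (deltaSel n) (m + 1) * cs.simple (bLetter n hn m)) <
      cs.length (partialProd hn cs (deltaSel n) (m + 1)) ↔ 1 ≤ m ∧ m ≤ n - 1 := by
  rcases Nat.eq_zero_or_pos m with rfl | h0
  · simp [pp_one]
  rcases Nat.lt_or_ge m n with h1 | h1
  · have e := pp_low hn cs m (by omega) (by omega)
    have e2 : partialProd hn cs (deltaSel n) (m + 1) * cs.simple (bLetter n hn m) =
        partialProd hn cs (deltaSel n) m := by
      rw [e, mul_assoc, cs.simple_mul_simple_self, mul_one]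
    rw [e2, len_low hn cs m (by omega) (by omega), len_low hn cs (m + 1) (by omega) (by omega)]
    omega
  rcases Nat.lt_or_ge m (3 * n - 3) with h2 | h2
  · have := mid_not hn cs (m + 1) (by omega) (by omega) _ (letter_mid hn m h1 h2)
    constructor
    · intro h; exact absurd h this
    · omega
  · obtain ⟨k, rfl⟩ := Nat.exists_eq_add_of_le h2
    have e : partialProd hn cs (deltaSel n) (3 * n - 3 + k + 1) *
        cs.simple (bLetter n hn (3 * n - 3 + k)) =
        partialProd hn cs (deltaSel n) (3 * n - 3 + k) := by
      rw [pp_succ hn cs _ hm, if_pos (by omega), mul_assoc, cs.simple_mul_simple_self, mul_one]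
    rw [e, add_assoc, pp_high hn cs k (by omega), pp_high hn cs (k + 1) (by omega),
      len_low hn cs _ (by omega) (by omega), len_low hn cs _ (by omega) (by omega)]
    omega

theorem card_fin (N : ℕ) (p : ℕ → Prop) [DecidablePred p] :
    (Finset.univ.filter fun i : Fin N => p i).card = ((Finset.range N).filter p).card := by
  rw [← Nat.Iio_eq_range, ← Fin.map_valEmbedding_univ, Finset.filter_map, Finset.card_map]
  rfl

theorem cardI_eq (hn : 2 ≤ n) : cardI (deltaSel n) = 2 * n - 2 := by
  unfold cardI deltaSel
  simp only [decide_eq_true_eq]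
  rw [card_fin (4 * n - 4) (fun i => (1 ≤ i ∧ i ≤ n - 1) ∨ 3 * n - 3 ≤ i)]
  have : (Finset.range (4 * n - 4)).filter (fun i => (1 ≤ i ∧ i ≤ n - 1) ∨ 3 * n - 3 ≤ i) =
      Finset.Ico 1 n ∪ Finset.Ico (3 * n - 3) (4 * n - 4) := by
    ext i
    simp only [Finset.mem_filter, Finset.mem_range, Finset.mem_union, Finset.mem_Ico]
    omega
  rw [this, Finset.card_union_of_disjoint]
  · simp only [Nat.card_Ico]; omega
  · rw [Finset.disjoint_left]
    intro i
    simp only [Finset.mem_Ico]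
    omega

theorem cardJ_eq : cardJ hn cs (deltaSel n) = n - 1 := by
  unfold cardJ
  have : ∀ i : Fin (4 * n - 4), _ := fun i => J_iff hn cs i i.2
  simp only [this]
  rw [card_fin (4 * n - 4) (fun i => 1 ≤ i ∧ i ≤ n - 1)]
  have : (Finset.range (4 * n - 4)).filter (fun i => 1 ≤ i ∧ i ≤ n - 1) = Finset.Ico 1 n := by
    ext i
    simp only [Finset.mem_filter, Finset.mem_range, Finset.mem_Ico]
    omega
  rw [this]
  simp only [Nat.card_Ico]

theorem prod_one : (List.ofFn (subexpr hn cs (deltaSel n))).prod = 1 := by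
  have h := pp_high hn cs (n - 1) le_rfl
  rw [show n - (n - 1) = 1 by omega, pp_one] at h
  unfold partialProd at h
  rwa [List.take_of_length_le (by simp; omega)] at h

/-- **The `(3n−3)`-dimensional Deodhar cell of the paper.**
For `n ≥ 2`, the subexpression `δ` of the reduced word `𝐰` is distinguished, its total
product is the identity, `|I(δ)| = 2n − 2`, `|J(δ)| = n − 1`, and consequently the
associated Deodhar cell `k^{|I(δ)|−|J(δ)|} × (kˣ)^{(4n−4)−|I(δ)|}` has dimension
`(4n−4) − |J(δ)| = 3n − 3`. -/
theorem delta_distinguished_card (hred : cs.IsReduced (bWord n hn)) :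
    Distinguished hn cs (deltaSel n) ∧
    (List.ofFn (subexpr hn cs (deltaSel n))).prod = 1 ∧
    cardI (deltaSel n) = 2 * n - 2 ∧
    cardJ hn cs (deltaSel n) = n - 1 ∧
    (cardI (deltaSel n) - cardJ hn cs (deltaSel n)) +
      ((4 * n - 4) - cardI (deltaSel n)) = 3 * n - 3 ∧
    (4 * n - 4) - cardJ hn cs (deltaSel n) = 3 * n - 3 := by
  have hI := cardI_eq hn
  have hJ := cardJ_eq hn cs
  refine ⟨dist hn cs, prod_one hn cs, hI, hJ, ?_, ?_⟩ <;> omega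

end DeodharBn
end

section
/- For n ≥ 2, in the Coxeter system (W_n, {t_1,…,t_n}) of type B_n with its standard reflection representation ρ on ℝⁿ, consider the reduced word 𝐰 = (t_n, t_{n−1}, …, t_2, t_1, t_2, …, t_{n−1}, t_n, t_{n−1}, …, t_2, t_1, t_2, …, t_{n−1}) of length 4n−4 with letter sequence (a_1,…,a_{4n−4}), and the subexpression γ = (1, t_{n−1}, …, t_2, 1, t_2, …, t_{n−1}, 1, t_{n−1}, …, t_2, 1, t_2, …, t_{n−1}). Then the subsequence of (ρ(γ^i)(β_{a_i}))_{1 ≤ i ≤ 4n−4} consisting of those entries lying in Φ⁺ has exactly 2n terms and equals the concatenation of two copies of the list (e_n − e_{n−1}, e_{n−1}, e_{n−1} − e_1, e_{n−1} − e_2, …, e_{n−1} − e_{n−2}). -/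
namespace DeodharBn

variable {n : ℕ} (hn : 2 ≤ n) {W : Type*} [Group W] (cs : CoxeterSystem (BnMatrix n) W)

/-- The Boolean encoding of the subexpression
`γ = (1, tₙ₋₁, …, t₂, 1, t₂, …, tₙ₋₁, 1, tₙ₋₁, …, t₂, 1, t₂, …, tₙ₋₁)` of `𝐰`:
`γ i = 1` precisely at the positions where the letter of `𝐰` is `t₁` or `tₙ`. -/
def gammaSel (n : ℕ) (hn : 2 ≤ n) (i : Fin (4 * n - 4)) : Bool :=
  decide (¬((bLetter n hn (i : ℕ) : ℕ) = 0 ∨ (bLetter n hn (i : ℕ) : ℕ) = n - 1))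

/-- total version of basis vectors -/
def eN (n : ℕ) (i : ℕ) : Fin n → ℝ := fun j => if (j : ℕ) = i then 1 else 0

theorem single_eq_eN (i : Fin n) : (Pi.single i 1 : Fin n → ℝ) = eN n (i : ℕ) := by
  funext j
  simp [eN, Pi.single_apply, Fin.ext_iff]

/-- total version of simple reflections -/
def sN (k : ℕ) : W := if h : k < n then cs.simple ⟨k, h⟩ else 1

theorem sN_mul_self (k : ℕ) : sN cs k * sN cs k = 1 := by
  unfold sN
  split_ifs <;> simp

/-- the descending products -/
def hP : ℕ → W
  | 0 => 1
  | j + 1 => hP j * sN cs (n - 2 - j)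

/-- index of the descending product -/
def idx (n r : ℕ) : ℕ := if r ≤ n - 2 then r else 2 * n - 3 - r

theorem bLetter_val (i : ℕ) : ((bLetter n hn i : Fin n) : ℕ) =
    if i % (2 * n - 2) ≤ n - 1 then n - 1 - i % (2 * n - 2) else i % (2 * n - 2) - n + 1 := by
  unfold bLetter
  split_ifs <;> rfl

theorem simple_eq_sN (i : Fin n) : cs.simple i = sN cs (i : ℕ) := by
  simp [sN]

theorem partialProd_succ (b : Fin (4 * n - 4) → Bool) (m : ℕ) (hm : m < 4 * n - 4) :
    partialProd hn cs b (m + 1) = partialProd hn cs b m * subexpr hn cs b ⟨m, hm⟩ := by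
  unfold partialProd
  rw [List.prod_take_succ _ _ (by simpa using hm)]
  simp

theorem succ_mod_cases (L m : ℕ) (hL : 0 < L) :
    (m % L + 1 = L ∧ (m + 1) % L = 0) ∨ (m % L + 1 < L ∧ (m + 1) % L = m % L + 1) := by
  have h1 := Nat.mod_lt m hL
  rcases Nat.lt_or_ge (m % L + 1) L with h | h
  · right
    refine ⟨h, ?_⟩
    rw [Nat.add_mod, Nat.mod_eq_of_lt (a := 1) (by omega), Nat.mod_eq_of_lt h]
  · left
    have h2 : m % L + 1 = L := by omega
    refine ⟨h2, ?_⟩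
    rw [← Nat.mod_add_mod, h2, Nat.mod_self]

theorem partialProd_eq (m : ℕ) (hm : m < 4 * n - 4) :
    partialProd hn cs (gammaSel n hn) (m + 1) = hP cs (idx n (m % (2 * n - 2))) := by
  induction m with
  | zero =>
    rw [partialProd_succ _ _ _ _ hm]
    have : ((bLetter n hn 0 : Fin n) : ℕ) = n - 1 := by
      rw [bLetter_val]; simp
    simp [partialProd, subexpr, gammaSel, this, idx, hP]
  | succ m ih =>
    rw [partialProd_succ _ _ _ _ hm, ih (by omega)]
    have hb := bLetter_val hn (m + 1)
    unfold subexpr gammaSel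
    simp only [decide_eq_true_eq]
    rw [simple_eq_sN]
    have hlt := Nat.mod_lt m (show 0 < 2 * n - 2 by omega)
    rcases succ_mod_cases (2 * n - 2) m (by omega) with ⟨h1, h2⟩ | ⟨h1, h2⟩
    · rw [h2] at hb ⊢
      rw [if_pos (by omega)] at hb
      rw [if_neg (by omega), mul_one]
      congr 1
      unfold idx
      split_ifs <;> omega
    · rw [h2] at hb ⊢
      generalize m % (2 * n - 2) = r at *
      rcases lt_trichotomy (r + 1) (n - 1) with h | h | h
      · rw [if_pos (by omega)] at hb
        rw [if_pos (by omega), hb]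
        have e1 : idx n r = r := by unfold idx; split_ifs <;> omega
        have e2 : idx n (r + 1) = r + 1 := by unfold idx; split_ifs <;> omega
        rw [e1, e2, hP]
        congr 2
        omega
      · rw [if_pos (by omega)] at hb
        rw [if_neg (by omega), mul_one]
        congr 1
        unfold idx
        split_ifs <;> omega
      · rw [if_neg (by omega)] at hb
        rw [if_pos (by omega), hb]
        have e1 : idx n r = (2 * n - 4 - r) + 1 := by unfold idx; split_ifs <;> omega
        have e2 : idx n (r + 1) = 2 * n - 4 - r := by unfold idx; split_ifs <;> omega
        rw [e1, e2, hP]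
        have e3 : n - 2 - (2 * n - 4 - r) = r + 1 - n + 1 := by omega
        rw [e3, mul_assoc, sN_mul_self, mul_one]

/-- the action -/
def act (ρ : W →* Matrix.GeneralLinearGroup (Fin n) ℝ) (w : W) (x : Fin n → ℝ) : Fin n → ℝ :=
  Matrix.mulVec (↑(ρ w) : Matrix (Fin n) (Fin n) ℝ) x

theorem act_one (ρ : W →* Matrix.GeneralLinearGroup (Fin n) ℝ) (x : Fin n → ℝ) :
    act ρ 1 x = x := by simp [act]

theorem act_mul (ρ : W →* Matrix.GeneralLinearGroup (Fin n) ℝ) (w w' : W) (x : Fin n → ℝ) :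
    act ρ (w * w') x = act ρ w (act ρ w' x) := by simp [act]

theorem act_sub (ρ : W →* Matrix.GeneralLinearGroup (Fin n) ℝ) (w : W) (x y : Fin n → ℝ) :
    act ρ w (x - y) = act ρ w x - act ρ w y := by simp [act, Matrix.mulVec_sub]

theorem hP_fix (ρ : W →* Matrix.GeneralLinearGroup (Fin n) ℝ)
    (h3 : ∀ k j, 1 ≤ k → k < n → j < n → j ≠ k - 1 → j ≠ k →
      act ρ (sN cs k) (eN n j) = eN n j)
    (j i : ℕ) (hj : j ≤ n - 2) (hi : i < n - 2 - j) :
    act ρ (hP cs j) (eN n i) = eN n i := by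
  induction j with
  | zero => exact act_one _ _
  | succ j ih =>
    rw [hP, act_mul, h3 _ _ (by omega) (by omega) (by omega) (by omega) (by omega),
      ih (by omega) (by omega)]

theorem hP_top (ρ : W →* Matrix.GeneralLinearGroup (Fin n) ℝ)
    (h1 : ∀ k, 1 ≤ k → k < n → act ρ (sN cs k) (eN n (k - 1)) = eN n k)
    (j : ℕ) (hj : j ≤ n - 2) :
    act ρ (hP cs j) (eN n (n - 2 - j)) = eN n (n - 2) := by
  induction j with
  | zero => exact act_one _ _
  | succ j ih =>
    have e : n - 2 - (j + 1) = (n - 2 - j) - 1 := by omega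
    rw [hP, act_mul, e, h1 _ (by omega) (by omega), ih (by omega)]

/-- the explicit root sequence in one period -/
def uN (n r : ℕ) : Fin n → ℝ :=
  if r = 0 then eN n (n - 1) - eN n (n - 2)
  else if r ≤ n - 2 then eN n (n - 2 - r) - eN n (n - 2)
  else if r = n - 1 then eN n (n - 2)
  else eN n (n - 2) - eN n (r - n)

theorem root_eq (hn : 2 ≤ n) (ρ : W →* Matrix.GeneralLinearGroup (Fin n) ℝ)
    (h1 : ∀ k, 1 ≤ k → k < n → act ρ (sN cs k) (eN n (k - 1)) = eN n k)
    (h2 : ∀ k, 1 ≤ k → k < n → act ρ (sN cs k) (eN n k) = eN n (k - 1))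
    (h3 : ∀ k j, 1 ≤ k → k < n → j < n → j ≠ k - 1 → j ≠ k →
      act ρ (sN cs k) (eN n j) = eN n j)
    (m k : ℕ) (hk : ((bLetter n hn m : Fin n) : ℕ) = k) :
    act ρ (hP cs (idx n (m % (2 * n - 2)))) (if k = 0 then eN n k else eN n k - eN n (k - 1))
      = uN n (m % (2 * n - 2)) := by
  rw [bLetter_val] at hk
  have hlt := Nat.mod_lt m (show 0 < 2 * n - 2 by omega)
  generalize m % (2 * n - 2) = r at *
  unfold idx uN
  by_cases c0 : r = 0
  · subst c0
    have : k = n - 1 := by simpa using hk.symm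
    subst this
    rw [if_pos (by omega), if_neg (by omega), if_pos rfl]
    have e : n - 1 - 1 = n - 2 := by omega
    rw [hP, act_one, e]
  rw [if_neg c0]
  by_cases c1 : r ≤ n - 2
  · rw [if_pos (by omega)] at hk
    rw [if_pos c1, if_pos c1, if_neg (by omega)]
    obtain ⟨j, rfl⟩ : ∃ j, r = j + 1 := ⟨r - 1, by omega⟩
    have e : k = n - 2 - j := by omega
    rw [hP, act_mul, ← e, act_sub, h1 _ (by omega) (by omega), h2 _ (by omega) (by omega),
      act_sub, hP_fix cs ρ h3 j _ (by omega) (by omega), e, hP_top cs ρ h1 j (by omega)]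
    congr 2
  rw [if_neg c1, if_neg c1]
  by_cases c2 : r = n - 1
  · rw [if_pos (by omega)] at hk
    rw [if_pos c2, if_pos (by omega)]
    have e : k = n - 2 - (2 * n - 3 - r) := by omega
    rw [e, hP_top cs ρ h1 _ (by omega)]
  · rw [if_neg (by omega)] at hk
    rw [if_neg c2, if_neg (by omega), act_sub]
    have e : k = n - 2 - (2 * n - 3 - r) := by omega
    have e' : k - 1 = r - n := by omega
    rw [e', hP_fix cs ρ h3 _ (r - n) (by omega) (by omega), e, hP_top cs ρ h1 _ (by omega)]

theorem filter_period (hn : 2 ≤ n) (p : (Fin n → ℝ) → Bool)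
    (p0 : p (eN n (n - 1) - eN n (n - 2)) = true)
    (p1 : p (eN n (n - 2)) = true)
    (p2 : ∀ j, j < n - 2 → p (eN n (n - 2) - eN n j) = true)
    (p3 : ∀ j, j < n - 2 → p (eN n j - eN n (n - 2)) = false) :
    ((List.range (2 * n - 2)).map (uN n)).filter p =
      (eN n (n - 1) - eN n (n - 2)) :: eN n (n - 2) ::
        (List.range (n - 2)).map (fun j => eN n (n - 2) - eN n j) := by
  have e : 2 * n - 2 = 1 + (n - 2) + 1 + (n - 2) := by omega
  have u0 : uN n 0 = eN n (n - 1) - eN n (n - 2) := by simp [uN]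
  have u1 : ∀ j, j < n - 2 → uN n (1 + j) = eN n (n - 2 - (1 + j)) - eN n (n - 2) := by
    intro j hj
    unfold uN
    rw [if_neg (by omega), if_pos (by omega)]
  have u2 : uN n (1 + (n - 2)) = eN n (n - 2) := by
    unfold uN
    rw [if_neg (by omega), if_neg (by omega), if_pos (by omega)]
  have u3 : ∀ j, uN n (1 + (n - 2) + 1 + j) = eN n (n - 2) - eN n j := by
    intro j
    unfold uN
    rw [if_neg (by omega), if_neg (by omega), if_neg (by omega)]
    congr 2
    omega
  have f1 : ((List.range (n - 2)).map (fun j => uN n (1 + j))).filter p = [] := by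
    rw [List.filter_eq_nil_iff]
    intro x hx
    obtain ⟨j, hj, rfl⟩ := List.mem_map.1 hx
    have hj' := List.mem_range.1 hj
    rw [u1 j hj', p3 _ (by omega)]
    simp
  have f3 : ((List.range (n - 2)).map (fun j => eN n (n - 2) - eN n j)).filter p =
      (List.range (n - 2)).map (fun j => eN n (n - 2) - eN n j) := by
    rw [List.filter_eq_self]
    intro x hx
    obtain ⟨j, hj, rfl⟩ := List.mem_map.1 hx
    exact p2 j (List.mem_range.1 hj)
  rw [e, List.range_add, List.range_add, List.range_add]
  simp only [List.map_append, List.filter_append, List.map_map, Function.comp_def]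
  rw [f1]
  simp only [u3, f3]
  simp [u0, u2, p0, p1]

open Classical in
/-- **The sequence `−Φ(γ)` for the `2n`-dimensional cell.**
Let `ρ : Wₙ → GL(ℝⁿ)` be the standard reflection representation of the Coxeter system of
type Bₙ (`ρ(t₁)` sends `e₁ ↦ −e₁` fixing the other basis vectors, and `ρ(tᵢ)` swaps
`e_{i−1}` and `e_i`; everything is `0`-based below, the paper's `e_i` being `e_{i−1}`).
For the subexpression `γ` of the reduced word `𝐰`, the subsequence of
`(ρ(γ^{i+1})(β_{a i}))_{0 ≤ i < 4n−4}` consisting of those entries lying in `Φ⁺` has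
exactly `2n` terms and equals the concatenation of two copies of the list
`(eₙ − e_{n−1}, e_{n−1}, e_{n−1} − e₁, e_{n−1} − e₂, …, e_{n−1} − e_{n−2})`
(in the paper's `1`-based notation). -/
theorem gamma_positive_root_sequence (hred : cs.IsReduced (bWord n hn))
    (ρ : W →* Matrix.GeneralLinearGroup (Fin n) ℝ)
    (hρ1 : Matrix.mulVec (↑(ρ (cs.simple ⟨0, by omega⟩)) : Matrix (Fin n) (Fin n) ℝ)
        (Pi.single (⟨0, by omega⟩ : Fin n) 1) = -Pi.single (⟨0, by omega⟩ : Fin n) 1)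
    (hρ1' : ∀ j : Fin n, (j : ℕ) ≠ 0 →
        Matrix.mulVec (↑(ρ (cs.simple ⟨0, by omega⟩)) : Matrix (Fin n) (Fin n) ℝ)
          (Pi.single j 1) = Pi.single j 1)
    (hρswap : ∀ i : Fin n, ∀ _hi : 1 ≤ (i : ℕ),
        Matrix.mulVec (↑(ρ (cs.simple i)) : Matrix (Fin n) (Fin n) ℝ)
            (Pi.single (⟨(i : ℕ) - 1, by have := i.isLt; omega⟩ : Fin n) 1) =
          Pi.single i 1 ∧
        Matrix.mulVec (↑(ρ (cs.simple i)) : Matrix (Fin n) (Fin n) ℝ) (Pi.single i 1) =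
          Pi.single (⟨(i : ℕ) - 1, by have := i.isLt; omega⟩ : Fin n) 1 ∧
        ∀ j : Fin n, (j : ℕ) ≠ (i : ℕ) - 1 → j ≠ i →
          Matrix.mulVec (↑(ρ (cs.simple i)) : Matrix (Fin n) (Fin n) ℝ)
            (Pi.single j 1) = Pi.single j 1) :
    let eb : Fin n → (Fin n → ℝ) := fun i => Pi.single i 1
    let Pos : Set (Fin n → ℝ) :=
      {v | (∃ i : Fin n, v = eb i) ∨ (∃ i j : Fin n, i < j ∧ v = eb j - eb i) ∨
        (∃ i j : Fin n, i < j ∧ v = eb j + eb i)}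
    let betaRoot : Fin n → (Fin n → ℝ) := fun i =>
      if (i : ℕ) = 0 then eb i else eb i - eb ⟨(i : ℕ) - 1, by have := i.isLt; omega⟩
    let v : Fin (4 * n - 4) → (Fin n → ℝ) := fun i =>
      Matrix.mulVec
        (↑(ρ (partialProd hn cs (gammaSel n hn) ((i : ℕ) + 1))) : Matrix (Fin n) (Fin n) ℝ)
        (betaRoot (bLetter n hn (i : ℕ)))
    let filtered : List (Fin n → ℝ) :=
      (List.ofFn v).filter fun x => decide (x ∈ Pos)
    let half : List (Fin n → ℝ) :=
      (eb ⟨n - 1, by omega⟩ - eb ⟨n - 2, by omega⟩) :: eb ⟨n - 2, by omega⟩ ::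
        List.ofFn (fun j : Fin (n - 2) =>
          eb ⟨n - 2, by omega⟩ - eb ⟨(j : ℕ), by have := j.isLt; omega⟩)
    filtered.length = 2 * n ∧ filtered = half ++ half := by
  intro eb Pos betaRoot v filtered half
  have heb : ∀ i : Fin n, eb i = eN n (i : ℕ) := fun i => single_eq_eN i
  have h1 : ∀ k, 1 ≤ k → k < n → act ρ (sN cs k) (eN n (k - 1)) = eN n k := by
    intro k hk hkn
    have := (hρswap ⟨k, hkn⟩ hk).1
    simpa only [single_eq_eN, simple_eq_sN, act] using this
  have h2 : ∀ k, 1 ≤ k → k < n → act ρ (sN cs k) (eN n k) = eN n (k - 1) := by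
    intro k hk hkn
    have := (hρswap ⟨k, hkn⟩ hk).2.1
    simpa only [single_eq_eN, simple_eq_sN, act] using this
  have h3 : ∀ k j, 1 ≤ k → k < n → j < n → j ≠ k - 1 → j ≠ k →
      act ρ (sN cs k) (eN n j) = eN n j := by
    intro k j hk hkn hj hj1 hj2
    have := (hρswap ⟨k, hkn⟩ hk).2.2 ⟨j, hj⟩ hj1 (by simpa [Fin.ext_iff] using hj2)
    simpa only [single_eq_eN, simple_eq_sN, act] using this
  have hv : ∀ i : Fin (4 * n - 4), v i = uN n ((i : ℕ) % (2 * n - 2)) := by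
    intro i
    rw [← root_eq cs hn ρ h1 h2 h3 i _ rfl, ← partialProd_eq hn cs i i.isLt]
    simp only [v, betaRoot, heb, act]
  have hp0 : eN n (n - 1) - eN n (n - 2) ∈ Pos :=
    Or.inr (Or.inl ⟨⟨n - 2, by omega⟩, ⟨n - 1, by omega⟩, by
      simp only [Fin.mk_lt_mk]; omega, by simp only [heb]⟩)
  have hp1 : eN n (n - 2) ∈ Pos := Or.inl ⟨⟨n - 2, by omega⟩, by simp only [heb]⟩
  have hp2 : ∀ j, j < n - 2 → eN n (n - 2) - eN n j ∈ Pos := fun j hj =>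
    Or.inr (Or.inl ⟨⟨j, by omega⟩, ⟨n - 2, by omega⟩, by
      simp only [Fin.mk_lt_mk]; omega, by simp only [heb]⟩)
  have hp3 : ∀ j, j < n - 2 → eN n j - eN n (n - 2) ∉ Pos := by
    intro j hj hmem
    have hbad : (eN n j - eN n (n - 2)) (⟨n - 2, by omega⟩ : Fin n) = -1 := by
      have : n - 2 ≠ j := by omega
      simp [eN, this]
    have hgood : (eN n j - eN n (n - 2)) (⟨j, by omega⟩ : Fin n) = 1 := by
      have : j ≠ n - 2 := by omega
      simp [eN, this]
    rcases hmem with ⟨a, ha⟩ | ⟨a, b, hab, ha⟩ | ⟨a, b, hab, ha⟩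
    · rw [ha, heb] at hbad
      simp only [eN] at hbad
      split_ifs at hbad <;> norm_num at hbad
    · rw [ha, heb, heb] at hbad hgood
      have hab' : (a : ℕ) < b := hab
      simp only [eN, Pi.sub_apply] at hbad hgood
      split_ifs at hbad hgood <;> first | omega | (norm_num at hbad; done) | (norm_num at hgood; done)
    · rw [ha, heb, heb] at hbad
      simp only [eN, Pi.add_apply] at hbad
      split_ifs at hbad <;> norm_num at hbad
  have hhalf : half = (eN n (n - 1) - eN n (n - 2)) :: eN n (n - 2) ::
        (List.range (n - 2)).map (fun j => eN n (n - 2) - eN n j) := by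
    simp only [half, heb]
    rw [← List.map_coe_finRange_eq_range, List.map_map, List.ofFn_eq_map]
    rfl
  have hper := filter_period hn (fun x => decide (x ∈ Pos)) (by simpa using hp0)
    (by simpa using hp1) (fun j hj => by simpa using hp2 j hj)
    (fun j hj => by simpa using hp3 j hj)
  have hlist : List.ofFn v = (List.range (2 * n - 2)).map (uN n) ++
      (List.range (2 * n - 2)).map (uN n) := by
    have e : List.ofFn v = (List.range (4 * n - 4)).map (fun i => uN n (i % (2 * n - 2))) := by
      rw [← List.map_coe_finRange_eq_range, List.map_map, List.ofFn_eq_map]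
      exact List.map_congr_left fun i _ => hv i
    have e2 : 4 * n - 4 = (2 * n - 2) + (2 * n - 2) := by omega
    rw [e, e2, List.range_add, List.map_append, List.map_map]
    congr 1
    · refine List.map_congr_left fun i hi => ?_
      rw [Nat.mod_eq_of_lt (List.mem_range.1 hi)]
    · refine List.map_congr_left fun i hi => ?_
      simp only [Function.comp_apply]
      rw [Nat.add_mod_left, Nat.mod_eq_of_lt (List.mem_range.1 hi)]
  have hfin : filtered = half ++ half := by
    simp only [filtered]
    rw [hlist, List.filter_append, hper, ← hhalf]
  refine ⟨?_, hfin⟩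
  rw [hfin, List.length_append]
  have : half.length = n := by
    simp [half]; omega
  omega

end DeodharBn
end
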